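/- For integers a, b ≥ 0 not both zero, let p = [2a+1] ⊔ [2a−1] ⊔ [2b−1] ⊔ [2b−1]. Then ((pᵗ)⁻)_C equals [2(a+b)] ⊔ [2(a−b)] if a ≥ b, and equals [2(a+b)] ⊔ [2(b−a)−2] if a < b. -/

import Mathlib

/-- A partition: a finite multiset of positive integers. -/
def IsPartition (p : Multiset ℕ) : Prop := ∀ x ∈ p, 0 < x

/-- The parts of `p` in weakly decreasing order. -/
def descList (p : Multiset ℕ) : List ℕ := (p.sort (· ≤ ·)).reverse

/-- The sum of the `j` largest parts of `p` (padding with trailing zeros). -/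
def topSum (p : Multiset ℕ) (j : ℕ) : ℕ := ((descList p).take j).sum

/-- Dominance order: `DomLE α β` means `α ≤ β`, i.e. each partial sum of the
largest parts of `α` is at most the corresponding partial sum for `β`. -/
def DomLE (α β : Multiset ℕ) : Prop := ∀ j : ℕ, topSum α j ≤ topSum β j

/-- Transpose of a partition: the `j`-th part is the number of parts `≥ j`. -/
def transposeP (p : Multiset ℕ) : Multiset ℕ :=
  ((Multiset.range p.sum).map fun j => (p.filter fun x => j + 1 ≤ x).card).filter
    fun c => c ≠ 0

/-- The weakly decreasing list of parts padded with zeros to length `n`. -/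
def padDesc (p : Multiset ℕ) (n : ℕ) : List ℕ :=
  descList p ++ List.replicate (n - Multiset.card p) 0

/-- The sum of two partitions: add the parts pointwise after sorting in
weakly decreasing order and padding with trailing zeros. -/
def sumParts (p q : Multiset ℕ) : Multiset ℕ :=
  (↑(List.zipWith (· + ·)
      (padDesc p (max (Multiset.card p) (Multiset.card q)))
      (padDesc q (max (Multiset.card p) (Multiset.card q)))) : Multiset ℕ).filter
    fun x => x ≠ 0

/-- The string `[a] = (a, a-2, a-4, …, 2 or 1)`, empty for `a = 0`. -/
def strP (a : ℕ) : Multiset ℕ := (Multiset.range ((a + 1) / 2)).map fun k => a - 2 * k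

/-- The partition `(a, a-1, …, 2, 1)`. -/
def downP (a : ℕ) : Multiset ℕ := (Multiset.range a).map fun k => a - k

/-- The partition `(2a-1, 2a-3, …, 3, 1)`. -/
def oddsDown (a : ℕ) : Multiset ℕ := (Multiset.range a).map fun k => 2 * (a - k) - 1

/-- The partition `(2a, 2a-2, …, 4, 2)`. -/
def evensDown (a : ℕ) : Multiset ℕ := (Multiset.range a).map fun k => 2 * (a - k)

/-- `p⁻`: decrease the smallest part of `p` by 1 (deleting it if it was 1). -/
def pMinus (p : Multiset ℕ) : Multiset ℕ :=
  match p.sort (· ≤ ·) with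
  | [] => 0
  | a :: rest => (↑rest : Multiset ℕ) + (if a ≤ 1 then 0 else {a - 1})

/-- A partition is symplectic if every odd part occurs with even multiplicity. -/
def IsSymplectic (p : Multiset ℕ) : Prop := ∀ x : ℕ, Odd x → Even (p.count x)

/-- A partition is orthogonal if every even part occurs with even multiplicity. -/
def IsOrthogonal (p : Multiset ℕ) : Prop := ∀ x : ℕ, Even x → Even (p.count x)

/-- `IsCCollapse p q`: `q` is the C-collapse `p_C` of `p`, i.e. the unique maximal
symplectic partition of the same total that is `≤ p` in the dominance order. -/
def IsCCollapse (p q : Multiset ℕ) : Prop :=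
  IsPartition q ∧ IsSymplectic q ∧ q.sum = p.sum ∧ DomLE q p ∧
    ∀ r : Multiset ℕ, IsPartition r → IsSymplectic r → r.sum = p.sum → DomLE r p → DomLE r q

theorem coe_descList (p : Multiset ℕ) : (↑(descList p) : Multiset ℕ) = p := by
  simp [descList]

theorem pairwise_descList (p : Multiset ℕ) : (descList p).Pairwise (· ≥ ·) := by
  simp [descList, List.pairwise_reverse]

theorem descList_coe {L : List ℕ} (hL : L.Pairwise (· ≥ ·)) : descList ↑L = L :=
  List.Perm.eq_of_pairwise' (r := (· ≥ ·)) (pairwise_descList _) hL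
    (Multiset.coe_eq_coe.1 (coe_descList _))

theorem topSum_coe {L : List ℕ} (hL : L.Pairwise (· ≥ ·)) (j : ℕ) :
    topSum ↑L j = (L.take j).sum := by
  rw [topSum, descList_coe hL]

theorem exists_pairwise_coe (p : Multiset ℕ) : ∃ L : List ℕ, L.Pairwise (· ≥ ·) ∧ ↑L = p :=
  ⟨descList p, pairwise_descList p, coe_descList p⟩

theorem topSum_zero (p : Multiset ℕ) : topSum p 0 = 0 := by
  simp [topSum]

theorem topSum_of_card_le {p : Multiset ℕ} {j : ℕ} (h : p.card ≤ j) : topSum p j = p.sum := by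
  obtain ⟨L, hL, rfl⟩ := exists_pairwise_coe p
  rw [topSum_coe hL, List.take_of_length_le (by simpa using h), Multiset.sum_coe]

theorem sum_take_filter_ne_zero {L : List ℕ} (hL : L.Pairwise (· ≥ ·)) (j : ℕ) :
    ((L.filter fun x => x ≠ 0).take j).sum = (L.take j).sum := by
  induction L generalizing j with
  | nil => simp
  | cons a L ih =>
    rw [List.pairwise_cons] at hL
    by_cases ha : a = 0
    · subst ha
      have hz : ∀ x ∈ L, x = 0 := fun x hx => Nat.le_zero.1 (hL.1 x hx)
      have h1 : (List.filter (fun x => decide (x ≠ 0)) (0 :: L)) = [] := by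
        simpa using hz
      rw [h1]
      symm
      simp only [List.take_nil, List.sum_nil]
      refine List.sum_eq_zero fun x hx => ?_
      rcases List.mem_cons.1 (List.mem_of_mem_take hx) with h | h
      exacts [h, hz x h]
    · cases j with
      | zero => simp
      | succ j =>
        rw [List.filter_cons_of_pos (by simpa using ha)]
        simp only [List.take_succ_cons, List.sum_cons, ih hL.2]

theorem topSum_filter_ne_zero (p : Multiset ℕ) (j : ℕ) :
    topSum (p.filter fun x => x ≠ 0) j = topSum p j := by
  obtain ⟨L, hL, rfl⟩ := exists_pairwise_coe p
  rw [Multiset.filter_coe, topSum_coe (hL.filter _), topSum_coe hL,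
    sum_take_filter_ne_zero hL]

theorem topSum_map_range {f : ℕ → ℕ} (hf : Antitone f) {N : ℕ} (hN : ∀ i, N ≤ i → f i = 0)
    (j : ℕ) : topSum ((Multiset.range N).map f) j = ∑ i ∈ Finset.range j, f i := by
  have hL : ((List.range N).map f).Pairwise (· ≥ ·) := by
    rw [List.pairwise_map]
    exact (List.pairwise_lt_range (n := N)).imp fun h => hf h.le
  have : (Multiset.range N).map f = ↑((List.range N).map f) := rfl
  rw [this, topSum_coe hL, ← List.map_take, List.take_range, ← Multiset.sum_coe]
  refine Finset.sum_subset (s₁ := Finset.range (min j N)) (by simp) fun i hi hi' => hN i ?_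
  simp only [Finset.mem_range] at hi hi'
  omega

theorem topSum_transposeP (p : Multiset ℕ) (j : ℕ) :
    topSum (transposeP p) j =
      ∑ i ∈ Finset.range j, (p.filter fun x => i + 1 ≤ x).card := by
  rw [transposeP, topSum_filter_ne_zero, topSum_map_range]
  · intro i k hik
    exact Multiset.card_le_card
      (Multiset.monotone_filter_right p fun x (hx : k + 1 ≤ x) => by omega)
  · intro i hi
    rw [Multiset.card_eq_zero, Multiset.filter_eq_nil]
    intro x hx
    have := Multiset.le_sum_of_mem hx
    omega

theorem pMinus_of_sort_eq_cons {p : Multiset ℕ} {a : ℕ} {L : List ℕ}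
    (h : p.sort (· ≤ ·) = a :: L) :
    pMinus p = (↑L : Multiset ℕ) + if a ≤ 1 then 0 else {a - 1} := by
  simp only [pMinus, h]

theorem topSum_pMinus {p : Multiset ℕ} (hp : IsPartition p) (j : ℕ) :
    topSum (pMinus p) j = min (topSum p j) (p.sum - 1) := by
  have hs := p.pairwise_sort (· ≤ ·)
  have hc := p.sort_eq (· ≤ ·)
  cases h : p.sort (· ≤ ·) with
  | nil => simp [pMinus, topSum, descList, h]
  | cons a L =>
    rw [h, List.pairwise_cons] at hs
    have ha : 0 < a := hp a (by rw [← hc, h]; simp)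
    have hL : L.reverse.Pairwise (· ≥ ·) := List.pairwise_reverse.2 hs.2
    have hM : (L.reverse ++ [a - 1]).Pairwise (· ≥ ·) := by
      rw [List.pairwise_append]
      refine ⟨hL, List.pairwise_singleton _ _, fun x hx y hy => ?_⟩
      have := hs.1 x (List.mem_reverse.1 hx)
      rw [List.mem_singleton] at hy
      omega
    have hm : topSum (pMinus p) j = ((L.reverse ++ [a - 1]).take j).sum := by
      rw [pMinus_of_sort_eq_cons h, ← topSum_coe hM, ← Multiset.coe_add, Multiset.coe_reverse]
      split_ifs with h1
      · rw [show a - 1 = 0 by omega, ← topSum_filter_ne_zero,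
          ← topSum_filter_ne_zero (↑L + ↑([0] : List ℕ))]
        simp [Multiset.filter_singleton]
      · rfl
    have hsum : p.sum = L.reverse.sum + a := by
      rw [← hc, h, Multiset.sum_coe, List.sum_cons, List.sum_reverse, add_comm]
    rw [hm, topSum, descList, h, hsum, List.reverse_cons]
    rcases lt_or_ge L.length j with hj | hj
    · rw [List.take_of_length_le (by simpa using hj), List.take_of_length_le (by simpa using hj)]
      simp only [List.sum_append, List.sum_singleton]
      omega
    · rw [List.take_append_of_le_length (by simpa using hj),
        List.take_append_of_le_length (by simpa using hj), eq_comm, min_eq_left]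
      have := (List.take_sublist j L.reverse).sum_le_sum fun _ _ => Nat.zero_le _
      omega

theorem sum_take_succ_getD (L : List ℕ) (j : ℕ) :
    (L.take (j + 1)).sum = (L.take j).sum + L.getD j 0 := by
  induction L generalizing j with
  | nil => simp
  | cons a L ih => cases j <;> simp [ih, add_assoc]

theorem topSum_succ (p : Multiset ℕ) (j : ℕ) :
    topSum p (j + 1) = topSum p j + (descList p).getD j 0 :=
  sum_take_succ_getD _ _

theorem take_eq_filter_of_getD_lt {L : List ℕ} (hL : L.Pairwise (· ≥ ·)) {j : ℕ}
    (h : L.getD (j + 1) 0 < L.getD j 0) :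
    L.take (j + 1) = L.filter fun x => L.getD j 0 ≤ x := by
  induction L generalizing j with
  | nil => simp at h
  | cons a L ih =>
    rw [List.pairwise_cons] at hL
    cases j with
    | zero =>
      have : L.filter (fun x => a ≤ x) = [] := by
        rw [List.filter_eq_nil_iff]
        intro x hx
        cases L with
        | nil => simp at hx
        | cons b L =>
          have hb := (List.pairwise_cons.1 hL.2).1
          simp only [List.getD_cons_succ, List.getD_cons_zero] at h
          rcases List.mem_cons.1 hx with rfl | hx
          · simpa using h
          · simpa using (hb x hx).trans_lt h
      simp [this]
    | succ j =>
      have h' : L.getD (j + 1) 0 < L.getD j 0 := by simpa using h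
      have hle : L.getD j 0 ≤ a := by
        by_cases hj : j < L.length
        · rw [List.getD_eq_getElem _ _ hj]
          exact hL.1 _ (List.getElem_mem hj)
        · rw [List.getD_eq_default _ _ (not_lt.1 hj)]
          exact Nat.zero_le _
      have := ih hL.2 h'
      rw [List.take_succ_cons, this, List.getD_cons_succ, List.filter_cons_of_pos (by simpa using hle)]

theorem IsSymplectic.even_sum {p : Multiset ℕ} (hp : IsSymplectic p) : Even p.sum := by
  rw [Finset.sum_multiset_count]
  refine Finset.even_sum _ fun x _ => ?_
  rcases Nat.even_or_odd x with hx | hx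
  · exact hx.mul_left _
  · exact (hp x hx).mul_right _

theorem IsSymplectic.filter_le {p : Multiset ℕ} (hp : IsSymplectic p) (v : ℕ) :
    IsSymplectic (p.filter fun x => v ≤ x) := by
  intro x hx
  rw [Multiset.count_filter]
  split_ifs
  exacts [hp x hx, Even.zero]

/-- A symplectic partition has even partial sums wherever its parts drop strictly. -/
theorem IsSymplectic.even_topSum {p : Multiset ℕ} (hp : IsSymplectic p) {j : ℕ}
    (h : (descList p).getD (j + 1) 0 < (descList p).getD j 0) : Even (topSum p (j + 1)) := by
  rw [topSum, take_eq_filter_of_getD_lt (pairwise_descList p) h, ← Multiset.sum_coe,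
    ← Multiset.filter_coe, coe_descList]
  exact (hp.filter_le _).even_sum

theorem eq_of_sum_take_eq {L M : List ℕ} (hL : ∀ x ∈ L, 0 < x) (hM : ∀ x ∈ M, 0 < x)
    (h : ∀ j, (L.take j).sum = (M.take j).sum) : L = M := by
  induction L generalizing M with
  | nil =>
    cases M with
    | nil => rfl
    | cons b M => have := h 1; have := hM b; simp_all
  | cons a L ih =>
    cases M with
    | nil => have := h 1; have := hL a; simp_all
    | cons b M =>
      have hab : a = b := by simpa using h 1
      subst hab
      rw [ih (fun x hx => hL x (List.mem_cons_of_mem _ hx))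
        (fun x hx => hM x (List.mem_cons_of_mem _ hx))]
      intro j
      simpa using h (j + 1)

theorem DomLE.antisymm {p q : Multiset ℕ} (hp : IsPartition p) (hq : IsPartition q)
    (h : DomLE p q) (h' : DomLE q p) : p = q := by
  rw [← coe_descList p, ← coe_descList q]
  congr 1
  refine eq_of_sum_take_eq (fun x hx => hp x ?_) (fun x hx => hq x ?_)
    fun j => (h j).antisymm (h' j)
  · rwa [← coe_descList p, Multiset.mem_coe]
  · rwa [← coe_descList q, Multiset.mem_coe]

theorem IsCCollapse.eq_of_isCCollapse {p q q' : Multiset ℕ} (h : IsCCollapse p q)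
    (h' : IsCCollapse p q') : q = q' :=
  DomLE.antisymm h.1 h'.1 (h'.2.2.2.2 q h.1 h.2.1 h.2.2.1 h.2.2.2.1)
    (h.2.2.2.2 q' h'.1 h'.2.1 h'.2.2.1 h'.2.2.2.1)

/-- A symplectic partition whose partial sums are bounded by those of `l` has partial sums
bounded by those of the even sequence `t` obtained by rounding the partial sums of `l` down. -/
theorem IsSymplectic.topSum_le {r : Multiset ℕ} (hr : IsSymplectic r) {l t : ℕ → ℕ}
    (hanti : Antitone l) (ht : ∀ i, Even (t i))
    (hle : ∀ j, ∑ i ∈ Finset.range j, t i ≤ ∑ i ∈ Finset.range j, l i)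
    (hge : ∀ j, ∑ i ∈ Finset.range j, l i ≤ ∑ i ∈ Finset.range j, t i + 1)
    (hl : ∀ j, Odd (∑ i ∈ Finset.range (j + 1), l i) → l (j + 1) < l j ∨ Even (l j))
    (hrl : ∀ j, topSum r j ≤ ∑ i ∈ Finset.range j, l i) (j : ℕ) :
    topSum r j ≤ ∑ i ∈ Finset.range j, t i := by
  induction j with
  | zero => simp [topSum_zero]
  | succ j ih =>
    by_contra! hlt
    have hte : ∀ j, Even (∑ i ∈ Finset.range j, t i) := fun j =>
      Finset.even_sum _ fun i _ => ht i
    have e0 := hte j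
    have e1 := hte (j + 1)
    have r0 := topSum_succ r j
    have r1 := topSum_succ r (j + 1)
    have l0 := Finset.sum_range_succ l j
    have l1 := Finset.sum_range_succ l (j + 1)
    have b0 := hrl j
    have b1 := hrl (j + 1)
    have b2 := hrl (j + 1 + 1)
    have c0 := hle j
    have c1 := hge (j + 1)
    have ev := hr.even_topSum (j := j)
    have hj := hl j
    have ha := hanti j.le_succ
    rw [Nat.succ_eq_add_one] at ha
    simp only [Nat.even_iff, Nat.odd_iff] at *
    have d0 := hge j
    rcases lt_or_ge ((descList r).getD (j + 1) 0) ((descList r).getD j 0) with h | h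
    · have := ev h
      omega
    · rcases hj (by omega) with h' | h' <;> omega

theorem strP_two_mul (c : ℕ) : strP (2 * c) = (Multiset.range c).map fun k => 2 * (c - k) := by
  rw [strP, show (2 * c + 1) / 2 = c by omega]
  exact Multiset.map_congr rfl fun k _ => by omega

theorem map_range_two_mul (f : ℕ → ℕ) (c : ℕ) :
    (Multiset.range (2 * c)).map f =
      (Multiset.range c).map (fun k => f (2 * k)) +
        (Multiset.range c).map (fun k => f (2 * k + 1)) := by
  induction c with
  | zero => simp
  | succ c ih =>
    rw [show 2 * (c + 1) = 2 * c + 1 + 1 by ring, Multiset.range_succ, Multiset.range_succ,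
      Multiset.range_succ]
    simp only [Multiset.map_cons, ih, Multiset.cons_add, Multiset.add_cons]

theorem strP_add_strP {f : ℕ → ℕ} {d c : ℕ} (h : ∀ i < d, f i = 2 * (d + c - i))
    (h0 : ∀ k < c, f (d + 2 * k) = 2 * (c - k))
    (h1 : ∀ k < c, f (d + (2 * k + 1)) = 2 * (c - k)) :
    strP (2 * (d + c)) + strP (2 * c) = (Multiset.range (d + 2 * c)).map f := by
  simp only [strP_two_mul, Multiset.range_add, Multiset.map_add, Multiset.map_map,
    Function.comp_def, map_range_two_mul, ← add_assoc]
  congr 1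
  · congr 1
    · exact Multiset.map_congr rfl fun k hk => (h k (Multiset.mem_range.1 hk)).symm
    · refine Multiset.map_congr rfl fun k hk => ?_
      rw [h0 k (Multiset.mem_range.1 hk)]
      omega
  · exact Multiset.map_congr rfl fun k hk => (h1 k (Multiset.mem_range.1 hk)).symm

theorem pos_even_of_mem_strP_two_mul {c x : ℕ} (hx : x ∈ strP (2 * c)) : 0 < x ∧ Even x := by
  rw [strP_two_mul, Multiset.mem_map] at hx
  obtain ⟨k, hk, rfl⟩ := hx
  have := Multiset.mem_range.1 hk
  exact ⟨by omega, even_two_mul _⟩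

theorem isSymplectic_of_forall_even {p : Multiset ℕ} (hp : ∀ x ∈ p, Even x) :
    IsSymplectic p := by
  intro x hx
  rw [Multiset.count_eq_zero_of_notMem fun h => Nat.not_even_iff_odd.2 hx (hp x h)]
  exact Even.zero

theorem card_filter_range_lt (n m : ℕ) :
    ((Multiset.range n).filter fun k => k < m).card = min n m := by
  induction n with
  | zero => simp
  | succ n ih =>
    rw [Multiset.range_succ, Multiset.filter_cons, Multiset.card_add, ih]
    split_ifs <;> simp <;> omega

theorem card_filter_strP_odd (n i : ℕ) :
    ((strP (2 * n - 1)).filter fun x => i + 1 ≤ x).card = n - (i + 1) / 2 := by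
  rw [strP, Multiset.filter_map, Multiset.card_map, ← min_eq_right (Nat.sub_le n ((i + 1) / 2)),
    ← card_filter_range_lt, show (2 * n - 1 + 1) / 2 = n by omega]
  congr 1
  refine Multiset.filter_congr fun k hk => ?_
  have := Multiset.mem_range.1 hk
  simp only [Function.comp]
  omega

/-- The parts of the transpose of `[2a+1] ⊔ [2a-1] ⊔ [2b-1] ⊔ [2b-1]`. -/
def transposeParts (a b i : ℕ) : ℕ :=
  (a + 1 - (i + 1) / 2) + (a - (i + 1) / 2) + (b - (i + 1) / 2) + (b - (i + 1) / 2)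

/-- The parts of the dual. -/
def dualParts (a b i : ℕ) : ℕ := 2 * (a - i / 2) + 2 * (b - (i + 1) / 2)

theorem sum_transposeParts (a b j : ℕ) :
    ∑ i ∈ Finset.range j, transposeParts a b i =
      ∑ i ∈ Finset.range j, dualParts a b i + if j ≤ 2 * a then j % 2 else 1 := by
  induction j with
  | zero => simp
  | succ j ih =>
    rw [Finset.sum_range_succ, Finset.sum_range_succ, ih]
    simp only [transposeParts, dualParts]
    split_ifs <;> omega

theorem exists_eq_map_dualParts (a b : ℕ) :
    ∃ c N, (if b ≤ a then strP (2 * (a + b)) + strP (2 * (a - b))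
          else strP (2 * (a + b)) + strP (2 * (b - a) - 2)) = strP (2 * (a + b)) + strP (2 * c) ∧
      strP (2 * (a + b)) + strP (2 * c) = (Multiset.range N).map (dualParts a b) ∧
      ∀ i, N ≤ i → dualParts a b i = 0 := by
  unfold dualParts
  split_ifs with h
  · refine ⟨a - b, 2 * b + 2 * (a - b), rfl, ?_, fun i hi => by omega⟩
    rw [show a + b = 2 * b + (a - b) by omega]
    apply strP_add_strP <;> intros <;> omega
  · refine ⟨b - a - 1, 2 * a + 1 + 2 * (b - a - 1), ?_, ?_, fun i hi => by omega⟩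
    · rw [show 2 * (b - a) - 2 = 2 * (b - a - 1) by omega]
    rw [show a + b = 2 * a + 1 + (b - a - 1) by omega]
    apply strP_add_strP <;> intros <;> omega

theorem isCCollapse_strP_add_strP (a b : ℕ) :
    IsCCollapse
      (pMinus (transposeP
        (strP (2 * a + 1) + strP (2 * a - 1) + strP (2 * b - 1) + strP (2 * b - 1))))
      (if b ≤ a then strP (2 * (a + b)) + strP (2 * (a - b))
        else strP (2 * (a + b)) + strP (2 * (b - a) - 2)) := by
  obtain ⟨c, N, h, hN, h0⟩ := exists_eq_map_dualParts a b
  rw [h]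
  set p := strP (2 * a + 1) + strP (2 * a - 1) + strP (2 * b - 1) + strP (2 * b - 1) with hp
  set t := strP (2 * (a + b)) + strP (2 * c) with ht
  have hmem : ∀ x ∈ t, 0 < x ∧ Even x := fun x hx =>
    (Multiset.mem_add.1 hx).elim pos_even_of_mem_strP_two_mul pos_even_of_mem_strP_two_mul
  have hP : IsPartition (transposeP p) := fun x hx =>
    Nat.pos_of_ne_zero (Multiset.mem_filter.1 hx).2
  have hT : ∀ j, topSum t j = ∑ i ∈ Finset.range j, dualParts a b i := by
    intro j
    rw [hN, topSum_map_range _ h0]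
    intro i k hik
    simp only [dualParts]
    omega
  have hΛ : ∀ j, topSum (transposeP p) j = ∑ i ∈ Finset.range j, transposeParts a b i := by
    intro j
    rw [topSum_transposeP]
    refine Finset.sum_congr rfl fun i _ => ?_
    simp only [hp, Multiset.filter_add, Multiset.card_add, card_filter_strP_odd]
    rw [show 2 * a + 1 = 2 * (a + 1) - 1 by omega, card_filter_strP_odd]
    rfl
  have hrel : ∀ j, topSum (transposeP p) j = topSum t j + if j ≤ 2 * a then j % 2 else 1 := by
    intro j
    rw [hΛ, hT, sum_transposeParts]
  have hsum : (transposeP p).sum = t.sum + 1 := by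
    have := hrel ((transposeP p).card + t.card + 2 * a + 1)
    rwa [topSum_of_card_le (by omega), topSum_of_card_le (by omega), if_neg (by omega)] at this
  have hM : ∀ j, topSum (pMinus (transposeP p)) j = min (topSum (transposeP p) j) t.sum := by
    intro j
    rw [topSum_pMinus hP, hsum, Nat.add_sub_cancel]
  have hMsum : (pMinus (transposeP p)).sum = t.sum := by
    have := hM ((pMinus (transposeP p)).card + (transposeP p).card)
    rw [topSum_of_card_le (by omega), topSum_of_card_le (by omega)] at this
    omega
  refine ⟨fun x hx => (hmem x hx).1, isSymplectic_of_forall_even fun x hx => (hmem x hx).2,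
    hMsum.symm, fun j => ?_, fun r _ hr _ hle j => ?_⟩
  · rw [hM, hrel]
    refine le_min (Nat.le_add_right _ _) ?_
    rw [topSum, ← coe_descList t, Multiset.sum_coe, coe_descList]
    exact (List.take_sublist _ _).sum_le_sum fun _ _ => Nat.zero_le _
  · rw [hT]
    refine hr.topSum_le (l := transposeParts a b) (fun i k hik => ?_) (fun i => ?_) (fun j => ?_) (fun j => ?_) (fun j hj => ?_)
      (fun j => ?_) j
    · simp only [transposeParts]
      omega
    · exact (even_two_mul _).add (even_two_mul _)
    · rw [sum_transposeParts]
      omega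
    · rw [sum_transposeParts]
      split_ifs <;> omega
    · have he : Even (∑ i ∈ Finset.range (j + 1), dualParts a b i) :=
        Finset.even_sum _ fun i _ => (even_two_mul _).add (even_two_mul _)
      rw [sum_transposeParts] at hj
      simp only [transposeParts]
      rw [Nat.odd_iff] at hj
      rw [Nat.even_iff] at he ⊢
      split_ifs at hj <;> omega
    · rw [← hΛ]
      exact (hle j).trans ((hM j).trans_le (min_le_left _ _))

/-- the hyperspecial-case computation of the Spaltenstein dual: for
`p = [2a+1] ⊔ [2a-1] ⊔ [2b-1] ⊔ [2b-1]`, the C-collapse of `(pᵗ)⁻` is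
`[2(a+b)] ⊔ [2(a-b)]` if `a ≥ b` and `[2(a+b)] ⊔ [2(b-a)-2]` if `a < b`. -/
theorem hyperspecial_dual (a b : ℕ) (hab : ¬ (a = 0 ∧ b = 0)) :
    ∀ q : Multiset ℕ,
      IsCCollapse
        (pMinus (transposeP
          (strP (2 * a + 1) + strP (2 * a - 1) + strP (2 * b - 1) + strP (2 * b - 1)))) q →
      q = if b ≤ a then strP (2 * (a + b)) + strP (2 * (a - b))
          else strP (2 * (a + b)) + strP (2 * (b - a) - 2) := by
  exact fun q hq => hq.eq_of_isCCollapse (isCCollapse_strP_add_strP a b)
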